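/- arXiv:2005.03218 — 2 statements merged into one kernel-verified Lean document; each statement's English description precedes it below -/
import Mathlib

section
/- Let F = (V; E, A) be a mixed graph, k ∈ ℕ, and f, g : V → ℕ with f ≤ g. There exist k edge- and arc-disjoint spanning mixed arborescences F₁,…,F_k with roots r₁,…,r_k such that f(v) ≤ #{i ∈ [k] : r_i = v} ≤ g(v) for every v ∈ V if and only if: (i) f̃(V) ≤ k; (ii) for every subpartition P = {X₁,…,X_t} of V, e_E(P) + ∑_{j=1}^t d_A^-(X_j) ≥ k(t−1) + f̃(V \ ∪_j X_j); and (iii) for every subpartition P = {X₁,…,X_t} of V, e_E(P) + ∑_{j=1}^t d_A^-(X_j) ≥ kt − g̃(∪_j X_j). -/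
open scoped Classical

/-- The in-degree `d_A^-(X)`: the number of arcs of the multiset `A` with head
in `X` and tail outside `X`. -/
def dIn {V : Type*} [DecidableEq V] (A : Multiset (V × V)) (X : Finset V) : ℕ :=
  (A.filter (fun a => a.2 ∈ X ∧ a.1 ∉ X)).card

/-- `e_E(P)`: the number of undirected edges of the multiset `E` having one
endpoint in some member of the family `P` and the other endpoint outside that
member (i.e. in a different member, or outside the union of `P`). -/
noncomputable def eCross {V : Type*} [DecidableEq V]
    (E : Multiset (Sym2 V)) (P : Finset (Finset V)) : ℕ :=
  (E.filter (fun e => ∃ u v : V, e = s(u, v) ∧ ∃ X ∈ P, u ∈ X ∧ v ∉ X)).card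

/-- `B` is a spanning `r`-arborescence on the vertex type `V`: every vertex is
reachable from `r`, no arc enters `r`, and every other vertex has exactly one
entering arc. -/
def IsSpanningArborescence {V : Type*} [DecidableEq V]
    (r : V) (B : Multiset (V × V)) : Prop :=
  (∀ v : V, Relation.ReflTransGen (fun a b : V => (a, b) ∈ B) r v) ∧
  (∀ p ∈ B, p.2 ≠ r) ∧
  (∀ v : V, v ≠ r → (B.filter (fun p => p.2 = v)).card = 1)

/-- `(E', A')` is a spanning `r`-mixed arborescence: there is an orientation
`O` of the undirected edges `E'` such that `A' + O` is a spanning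
`r`-arborescence. -/
def IsSpanningMixedArborescence {V : Type*} [DecidableEq V]
    (r : V) (E' : Multiset (Sym2 V)) (A' : Multiset (V × V)) : Prop :=
  ∃ O : Multiset (V × V),
    O.map (fun p => s(p.1, p.2)) = E' ∧ IsSpanningArborescence r (A' + O)

/-- `P` is a subpartition of the vertex set: a family of pairwise disjoint
nonempty subsets. -/
def IsSubpartition {V : Type*} [DecidableEq V] (P : Finset (Finset V)) : Prop :=
  (∀ X ∈ P, X.Nonempty) ∧ (P : Set (Finset V)).Pairwise Disjoint


section Uncross
variable {V : Type*} [DecidableEq V]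

lemma mem_supid (P : Finset (Finset V)) (v : V) : v ∈ P.sup id ↔ ∃ X ∈ P, v ∈ X := by
  simp [Finset.mem_sup]

lemma uncross1 (b : Finset V → ℤ)
    (hb : ∀ X Y, (X ∩ Y).Nonempty → b X + b Y ≤ b (X ∪ Y) + b (X ∩ Y)) (X : Finset V)
    (S : Finset (Finset V)) (hS : (S : Set (Finset V)).Pairwise Disjoint)
    (hX : ∀ Y ∈ S, (X ∩ Y).Nonempty) :
    b X + ∑ Y ∈ S, b Y ≤ b (X ∪ S.sup id) + ∑ Y ∈ S, b (X ∩ Y) := by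
  induction S using Finset.induction_on with
  | empty => simp
  | insert Y S hY ih =>
    have ih' := ih (hS.mono (by simp)) (fun Z hZ => hX Z (Finset.mem_insert_of_mem hZ))
    rw [Finset.sum_insert hY, Finset.sum_insert hY, Finset.sup_insert]
    have hd : ∀ Z ∈ S, Disjoint Z Y := by
      intro Z hZ
      apply hS (by simp [hZ]) (by simp)
      rintro rfl; exact hY hZ
    have e1 : (X ∪ S.sup id) ∩ Y = X ∩ Y := by
      ext v
      simp only [Finset.mem_inter, Finset.mem_union, mem_supid]
      constructor
      · rintro ⟨h | ⟨Z, hZ, hv⟩, h2⟩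
        · exact ⟨h, h2⟩
        · exact absurd h2 (Finset.disjoint_left.1 (hd Z hZ) hv)
      · rintro ⟨h, h2⟩; exact ⟨Or.inl h, h2⟩
    have e2 : X ∪ (id Y ⊔ S.sup id) = (X ∪ S.sup id) ∪ Y := by
      ext v; simp only [Finset.mem_union, Finset.sup_eq_union, id]; tauto
    have := hb (X ∪ S.sup id) Y (by rw [e1]; exact hX Y (by simp))
    rw [e1] at this
    rw [e2]
    linarith

lemma uncross2 (b : Finset V → ℤ)
    (hb : ∀ X Y, (X ∩ Y).Nonempty → b X + b Y ≤ b (X ∪ Y) + b (X ∩ Y)) (X : Finset V)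
    (hXn : X.Nonempty) (P : Finset (Finset V)) (hP : IsSubpartition P) :
    ∃ P' Q' : Finset (Finset V), IsSubpartition P' ∧ IsSubpartition Q' ∧
      P'.sup id = P.sup id ∪ X ∧ Q'.sup id = P.sup id ∩ X ∧
      ∑ Y ∈ P, b Y + b X ≤ ∑ Y ∈ P', b Y + ∑ Y ∈ Q', b Y := by
  set S := P.filter (fun Y => (X ∩ Y).Nonempty) with hS
  set T := P.filter (fun Y => ¬ (X ∩ Y).Nonempty) with hT
  have hSP : ∀ Y ∈ S, Y ∈ P := fun Y h => (Finset.mem_filter.1 h).1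
  have hTP : ∀ Y ∈ T, Y ∈ P := fun Y h => (Finset.mem_filter.1 h).1
  have hSX : ∀ Y ∈ S, (X ∩ Y).Nonempty := fun Y h => (Finset.mem_filter.1 h).2
  have hTX : ∀ Y ∈ T, Disjoint X Y := fun Y h => by
    have := (Finset.mem_filter.1 h).2
    rwa [Finset.not_nonempty_iff_eq_empty, ← Finset.disjoint_iff_inter_eq_empty] at this
  have hSd : (S : Set (Finset V)).Pairwise Disjoint := hP.2.mono (fun Y h => hSP Y h)
  have key := uncross1 b hb X S hSd hSX
  have hM : ∀ Y ∈ T, Disjoint (X ∪ S.sup id) Y := by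
    intro Y hY
    rw [Finset.disjoint_left]
    intro v hv hvY
    rcases Finset.mem_union.1 hv with h | h
    · exact Finset.disjoint_left.1 (hTX Y hY) h hvY
    · obtain ⟨Z, hZ, hvZ⟩ := (mem_supid _ _).1 h
      have : Z ≠ Y := by
        rintro rfl
        exact (Finset.mem_filter.1 hY).2 (hSX _ hZ)
      exact Finset.disjoint_left.1 (hP.2 (hSP _ hZ) (hTP _ hY) this) hvZ hvY
  have hMn : (X ∪ S.sup id).Nonempty := hXn.mono Finset.subset_union_left
  have hMT : (X ∪ S.sup id) ∉ T := by
    intro h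
    have := hM _ h
    rw [disjoint_self] at this
    exact hMn.ne_empty this
  have hinj : Set.InjOn (fun Y => X ∩ Y) (S : Set (Finset V)) := by
    intro Y hY Z hZ h
    by_contra hne
    obtain ⟨v, hv⟩ := hSX Y hY
    have hv2 : v ∈ X ∩ Z := by
      have : X ∩ Y = X ∩ Z := h
      rwa [← this]
    exact Finset.disjoint_left.1 (hSd hY hZ hne) (Finset.mem_inter.1 hv).2 (Finset.mem_inter.1 hv2).2
  refine ⟨insert (X ∪ S.sup id) T, S.image (fun Y => X ∩ Y), ⟨?_, ?_⟩, ⟨?_, ?_⟩, ?_, ?_, ?_⟩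
  · intro Y hY
    rcases Finset.mem_insert.1 hY with rfl | h
    · exact hMn
    · exact hP.1 _ (hTP _ h)
  · intro Y hY Z hZ hne
    rcases Finset.mem_insert.1 hY with rfl | h <;> rcases Finset.mem_insert.1 hZ with rfl | h'
    · exact absurd rfl hne
    · exact hM _ h'
    · exact (hM _ h).symm
    · exact hP.2 (hTP _ h) (hTP _ h') hne
  · intro Y hY
    obtain ⟨Z, hZ, rfl⟩ := Finset.mem_image.1 hY
    exact hSX _ hZ
  · intro Y hY Z hZ hne
    obtain ⟨Y', hY', rfl⟩ := Finset.mem_image.1 hY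
    obtain ⟨Z', hZ', rfl⟩ := Finset.mem_image.1 hZ
    have : Y' ≠ Z' := by rintro rfl; exact hne rfl
    exact (hSd hY' hZ' this).mono Finset.inter_subset_right Finset.inter_subset_right
  · ext v
    simp only [mem_supid, Finset.mem_insert, Finset.mem_union]
    constructor
    · rintro ⟨Y, rfl | h, hv⟩
      · rcases Finset.mem_union.1 hv with h | h
        · exact Or.inr h
        · obtain ⟨Z, hZ, hvZ⟩ := (mem_supid _ _).1 h
          exact Or.inl ⟨Z, hSP _ hZ, hvZ⟩
      · exact Or.inl ⟨Y, hTP _ h, hv⟩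
    · rintro (⟨Y, hY, hv⟩ | h)
      · by_cases hXY : (X ∩ Y).Nonempty
        · exact ⟨_, Or.inl rfl, Finset.mem_union_right _
            ((mem_supid _ _).2 ⟨Y, Finset.mem_filter.2 ⟨hY, hXY⟩, hv⟩)⟩
        · exact ⟨Y, Or.inr (Finset.mem_filter.2 ⟨hY, hXY⟩), hv⟩
      · exact ⟨_, Or.inl rfl, Finset.mem_union_left _ h⟩
  · ext v
    simp only [mem_supid, Finset.mem_inter, Finset.mem_image]
    constructor
    · rintro ⟨_, ⟨Y, hY, rfl⟩, hv⟩
      exact ⟨⟨Y, hSP _ hY, (Finset.mem_inter.1 hv).2⟩, (Finset.mem_inter.1 hv).1⟩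
    · rintro ⟨⟨Y, hY, hv⟩, hvX⟩
      have hvXY : v ∈ X ∩ Y := Finset.mem_inter.2 ⟨hvX, hv⟩
      exact ⟨_, ⟨Y, Finset.mem_filter.2 ⟨hY, ⟨v, hvXY⟩⟩, rfl⟩, hvXY⟩
  · rw [Finset.sum_insert hMT, Finset.sum_image hinj]
    have := Finset.sum_filter_add_sum_filter_not P (fun Y => (X ∩ Y).Nonempty) b
    rw [← hS, ← hT] at this
    linarith

lemma uncross3 (b : Finset V → ℤ)
    (hb : ∀ X Y, (X ∩ Y).Nonempty → b X + b Y ≤ b (X ∪ Y) + b (X ∩ Y))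
    (Q : Finset (Finset V)) (P : Finset (Finset V)) (hQ : IsSubpartition Q)
    (hP : IsSubpartition P) :
    ∃ P' Q' : Finset (Finset V), IsSubpartition P' ∧ IsSubpartition Q' ∧
      P'.sup id = P.sup id ∪ Q.sup id ∧ Q'.sup id = P.sup id ∩ Q.sup id ∧
      ∑ Y ∈ P, b Y + ∑ Y ∈ Q, b Y ≤ ∑ Y ∈ P', b Y + ∑ Y ∈ Q', b Y := by
  induction Q using Finset.induction_on with
  | empty => exact ⟨P, ∅, hP, hQ, by simp, by simp, by simp⟩
  | insert X Q hX ih =>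
    have hQ' : IsSubpartition Q :=
      ⟨fun Y hY => hQ.1 Y (Finset.mem_insert_of_mem hY), hQ.2.mono (by simp)⟩
    obtain ⟨P1, Q1, hP1, hQ1, e1, e2, hle⟩ := ih hQ'
    obtain ⟨P2, Q2, hP2, hQ2, e3, e4, hle2⟩ :=
      uncross2 b hb X (hQ.1 X (by simp)) P1 hP1
    have hd : ∀ Z ∈ Q, Disjoint Z X := by
      intro Z hZ
      apply hQ.2 (by simp [hZ]) (by simp)
      rintro rfl; exact hX hZ
    have hd2 : Disjoint (Q.sup id) X := by
      rw [Finset.disjoint_left]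
      intro v hv hvX
      obtain ⟨Z, hZ, h⟩ := (mem_supid _ _).1 hv
      exact Finset.disjoint_left.1 (hd Z hZ) h hvX
    have e5 : Q2.sup id = P.sup id ∩ X := by
      rw [e4, e1, Finset.union_inter_distrib_right, Finset.disjoint_iff_inter_eq_empty.1 hd2,
        Finset.union_empty]
    have hdd : ∀ Y ∈ Q1, ∀ Z ∈ Q2, Disjoint Y Z := by
      intro Y hY Z hZ
      have h1 : Y ⊆ Q1.sup id := Finset.le_sup (f := id) hY
      have h2 : Z ⊆ Q2.sup id := Finset.le_sup (f := id) hZ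
      rw [e2] at h1; rw [e5] at h2
      exact hd2.mono (h1.trans Finset.inter_subset_right) (h2.trans Finset.inter_subset_right)
    have hdj : Disjoint Q1 Q2 := by
      rw [Finset.disjoint_left]
      intro Y h1 h2
      have := hdd Y h1 Y h2
      rw [disjoint_self] at this
      exact (hQ1.1 Y h1).ne_empty this
    refine ⟨P2, Q1 ∪ Q2, hP2, ⟨?_, ?_⟩, ?_, ?_, ?_⟩
    · intro Y hY
      rcases Finset.mem_union.1 hY with h | h
      · exact hQ1.1 _ h
      · exact hQ2.1 _ h
    · intro Y hY Z hZ hne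
      rcases Finset.mem_union.1 hY with h | h <;> rcases Finset.mem_union.1 hZ with h' | h'
      · exact hQ1.2 h h' hne
      · exact hdd _ h _ h'
      · exact (hdd _ h' _ h).symm
      · exact hQ2.2 h h' hne
    · rw [e3, e1, Finset.sup_insert]
      ext v; simp only [Finset.mem_union, Finset.sup_eq_union, id]; tauto
    · rw [Finset.sup_union, e2, e5, Finset.sup_insert]
      ext v; simp only [Finset.mem_union, Finset.sup_eq_union, id, Finset.mem_inter]; tauto
    · rw [Finset.sum_union hdj, Finset.sum_insert hX]
      linarith

/-- Choice of root vector. -/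
lemma choose_roots [Fintype V] (b t : Finset V → ℤ) (k : ℤ)
    (hb : ∀ X Y, (X ∩ Y).Nonempty → b X + b Y ≤ b (X ∪ Y) + b (X ∩ Y))
    (ht : ∀ X Y, t (X ∪ Y) + t (X ∩ Y) ≤ t X + t Y) (n : ℕ) :
    ∀ (f g : V → ℤ) (_ : ∀ v, f v ≤ g v) (_ : ∑ v, (g v - f v) = n)
    (_ : ∀ P, IsSubpartition P → ∑ X ∈ P, b X ≤ t (P.sup id) + k - ∑ v ∈ Finset.univ \ P.sup id, f v)
    (_ : ∀ P, IsSubpartition P → ∑ X ∈ P, b X ≤ t (P.sup id) + ∑ v ∈ P.sup id, g v),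
    ∃ m : V → ℤ, (∀ v, f v ≤ m v ∧ m v ≤ g v) ∧
      (∀ P, IsSubpartition P → ∑ X ∈ P, b X ≤ t (P.sup id) + k - ∑ v ∈ Finset.univ \ P.sup id, m v) ∧
      (∀ P, IsSubpartition P → ∑ X ∈ P, b X ≤ t (P.sup id) + ∑ v ∈ P.sup id, m v) := by
  induction n with
  | zero =>
    intro f g hfg hs h1 h2
    have : ∀ v, f v = g v := by
      intro v
      have := (Finset.sum_eq_zero_iff_of_nonneg (fun v _ => sub_nonneg.2 (hfg v))).1
        (by simpa using hs) v (Finset.mem_univ v)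
      linarith
    have : f = g := funext this
    subst this
    exact ⟨f, fun v => ⟨le_rfl, le_rfl⟩, h1, h2⟩
  | succ n ih =>
    intro f g hfg hs h1 h2
    obtain ⟨v, hv⟩ : ∃ v, f v < g v := by
      by_contra hcon
      push Not at hcon
      have : ∑ v, (g v - f v) ≤ 0 := Finset.sum_nonpos (fun v _ => by linarith [hcon v])
      rw [hs] at this
      push_cast at this
      linarith
    have upd : ∀ (h : V → ℤ) (c : ℤ) (Z : Finset V),
        ∑ w ∈ Z, (h w + if w = v then c else 0) = ∑ w ∈ Z, h w + if v ∈ Z then c else 0 := by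
      intro h c Z
      rw [Finset.sum_add_distrib, Finset.sum_ite_eq']
    by_cases hA : ∀ P, IsSubpartition P → ∑ X ∈ P, b X ≤ t (P.sup id) + k -
        ∑ w ∈ Finset.univ \ P.sup id, (f w + if w = v then 1 else 0)
    · obtain ⟨m, hm, h3, h4⟩ := ih (fun w => f w + if w = v then 1 else 0) g
        (fun w => by
          by_cases h : w = v
          · subst h; simp; linarith
          · simp [h, hfg w])
        (by
          have := upd (fun w => f w - g w) 1 Finset.univ
          simp only [Finset.sum_sub_distrib, Finset.sum_add_distrib] at this hs ⊢
          simp at this hs ⊢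
          linarith) hA h2
      refine ⟨m, fun w => ⟨?_, (hm w).2⟩, h3, h4⟩
      have := (hm w).1
      split_ifs at this <;> linarith
    by_cases hB : ∀ P, IsSubpartition P → ∑ X ∈ P, b X ≤ t (P.sup id) +
        ∑ w ∈ P.sup id, (g w + if w = v then -1 else 0)
    · obtain ⟨m, hm, h3, h4⟩ := ih f (fun w => g w + if w = v then -1 else 0)
        (fun w => by
          by_cases h : w = v
          · subst h; simp; linarith
          · simp [h, hfg w])
        (by
          simp only [Finset.sum_sub_distrib, Finset.sum_add_distrib] at hs ⊢
          simp at hs ⊢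
          linarith) h1 hB
      refine ⟨m, fun w => ⟨(hm w).1, ?_⟩, h3, h4⟩
      have := (hm w).2
      split_ifs at this <;> linarith
    exfalso
    push Not at hA hB
    obtain ⟨P, hP, hPl⟩ := hA
    obtain ⟨Q, hQ, hQl⟩ := hB
    rw [upd] at hPl hQl
    have hvP : v ∈ Finset.univ \ P.sup id := by
      by_contra hcon
      rw [if_neg hcon] at hPl
      linarith [h1 P hP]
    have hvQ : v ∈ Q.sup id := by
      by_contra hcon
      rw [if_neg hcon] at hQl
      linarith [h2 Q hQ]
    rw [if_pos hvP] at hPl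
    rw [if_pos hvQ] at hQl
    obtain ⟨P', Q', hP', hQ', e1, e2, hle⟩ := uncross3 b hb Q P hQ hP
    have a1 := h1 P' hP'
    have a2 := h2 Q' hQ'
    rw [e1] at a1
    rw [e2] at a2
    have a3 := ht (P.sup id) (Q.sup id)
    generalize P.sup id = Z at *
    generalize Q.sup id = W at *
    have s1 : ∑ w ∈ Finset.univ \ Z, f w = ∑ w ∈ Finset.univ \ (Z ∪ W), f w + ∑ w ∈ W \ Z, f w := by
      rw [← Finset.sum_union]
      · congr 1; ext w; simp; tauto
      · rw [Finset.disjoint_left]; intro w; simp; tauto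
    have s2 : ∑ w ∈ W, g w = ∑ w ∈ Z ∩ W, g w + ∑ w ∈ W \ Z, g w := by
      rw [← Finset.sum_union]
      · congr 1; ext w; simp; tauto
      · rw [Finset.disjoint_left]; intro w; simp; tauto
    have s3 : ∑ w ∈ W \ Z, f w < ∑ w ∈ W \ Z, g w :=
      Finset.sum_lt_sum (fun w _ => hfg w) ⟨v, by simp at hvP ⊢; tauto, hv⟩
    linarith

end Uncross

section Graph
set_option linter.unusedSectionVars false
variable {V : Type*} [DecidableEq V]

lemma dIn_zero (X : Finset V) : dIn (0 : Multiset (V × V)) X = 0 := by simp [dIn]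

lemma dIn_add (A B : Multiset (V × V)) (X : Finset V) : dIn (A + B) X = dIn A X + dIn B X := by
  simp [dIn]

lemma dIn_cons (p : V × V) (A : Multiset (V × V)) (X : Finset V) :
    dIn (p ::ₘ A) X = dIn A X + if p.2 ∈ X ∧ p.1 ∉ X then 1 else 0 := by
  unfold dIn
  rw [Multiset.filter_cons]
  split_ifs <;> simp [add_comm]

lemma dIn_submod (A : Multiset (V × V)) (X Y : Finset V) :
    dIn A (X ∪ Y) + dIn A (X ∩ Y) ≤ dIn A X + dIn A Y := by
  induction A using Multiset.induction_on with
  | empty => simp [dIn_zero]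
  | cons p A ih =>
    simp only [dIn_cons, Finset.mem_union, Finset.mem_inter]
    by_cases h1 : p.1 ∈ X <;> by_cases h2 : p.2 ∈ X <;> by_cases h3 : p.1 ∈ Y <;>
      by_cases h4 : p.2 ∈ Y <;> simp [h1, h2, h3, h4] <;> omega

lemma dIn_mono {A B : Multiset (V × V)} (h : A ≤ B) (X : Finset V) : dIn A X ≤ dIn B X :=
  Multiset.card_le_card (Multiset.filter_le_filter _ h)

/-- number of edges touching `Z` -/
noncomputable def touchE (E : Multiset (Sym2 V)) (Z : Finset V) : ℕ :=
  (E.filter (fun e => ∃ v ∈ Z, v ∈ e)).card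

/-- number of edges inside `Z` -/
noncomputable def insE (E : Multiset (Sym2 V)) (Z : Finset V) : ℕ :=
  (E.filter (fun e => ∀ v ∈ e, v ∈ Z)).card

lemma touchE_zero (Z : Finset V) : touchE (0 : Multiset (Sym2 V)) Z = 0 := by simp [touchE]
lemma insE_zero (Z : Finset V) : insE (0 : Multiset (Sym2 V)) Z = 0 := by simp [insE]

lemma touchE_cons (u v : V) (E : Multiset (Sym2 V)) (Z : Finset V) :
    touchE (s(u, v) ::ₘ E) Z = touchE E Z + if u ∈ Z ∨ v ∈ Z then 1 else 0 := by
  unfold touchE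
  have : (∃ w ∈ Z, w ∈ s(u, v)) ↔ (u ∈ Z ∨ v ∈ Z) := by
    simp only [Sym2.mem_iff]
    constructor
    · rintro ⟨w, h, rfl | rfl⟩ <;> tauto
    · rintro (h | h)
      · exact ⟨u, h, Or.inl rfl⟩
      · exact ⟨v, h, Or.inr rfl⟩
  by_cases h : u ∈ Z ∨ v ∈ Z
  · rw [Multiset.filter_cons_of_pos (p := fun e : Sym2 V => ∃ v ∈ Z, v ∈ e) _ (this.2 h), if_pos h]; simp
  · rw [Multiset.filter_cons_of_neg (p := fun e : Sym2 V => ∃ v ∈ Z, v ∈ e) _ (fun h' => h (this.1 h')), if_neg h]; simp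

lemma insE_cons (u v : V) (E : Multiset (Sym2 V)) (Z : Finset V) :
    insE (s(u, v) ::ₘ E) Z = insE E Z + if u ∈ Z ∧ v ∈ Z then 1 else 0 := by
  unfold insE
  have : (∀ w ∈ s(u, v), w ∈ Z) ↔ (u ∈ Z ∧ v ∈ Z) := by
    simp only [Sym2.mem_iff]
    constructor
    · intro h; exact ⟨h u (Or.inl rfl), h v (Or.inr rfl)⟩
    · rintro ⟨h1, h2⟩ w (rfl | rfl) <;> assumption
  by_cases h : u ∈ Z ∧ v ∈ Z
  · rw [Multiset.filter_cons_of_pos (p := fun e : Sym2 V => ∀ v ∈ e, v ∈ Z) _ (this.2 h), if_pos h]; simp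
  · rw [Multiset.filter_cons_of_neg (p := fun e : Sym2 V => ∀ v ∈ e, v ∈ Z) _ (fun h' => h (this.1 h')), if_neg h]; simp

lemma eCross_zero (P : Finset (Finset V)) : eCross (0 : Multiset (Sym2 V)) P = 0 := by
  simp [eCross]

lemma eCross_cons (u v : V) (E : Multiset (Sym2 V)) (P : Finset (Finset V)) :
    eCross (s(u, v) ::ₘ E) P = eCross E P +
      if (∃ X ∈ P, u ∈ X ∧ v ∉ X) ∨ (∃ X ∈ P, v ∈ X ∧ u ∉ X) then 1 else 0 := by
  unfold eCross
  have : (∃ u' v' : V, s(u, v) = s(u', v') ∧ ∃ X ∈ P, u' ∈ X ∧ v' ∉ X) ↔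
      ((∃ X ∈ P, u ∈ X ∧ v ∉ X) ∨ (∃ X ∈ P, v ∈ X ∧ u ∉ X)) := by
    constructor
    · rintro ⟨u', v', h, hX⟩
      rcases Sym2.eq_iff.1 h with ⟨rfl, rfl⟩ | ⟨rfl, rfl⟩
      · exact Or.inl hX
      · exact Or.inr hX
    · rintro (h | h)
      · exact ⟨u, v, rfl, h⟩
      · exact ⟨v, u, Sym2.eq_swap, h⟩
  by_cases h : (∃ X ∈ P, u ∈ X ∧ v ∉ X) ∨ (∃ X ∈ P, v ∈ X ∧ u ∉ X)
  · rw [Multiset.filter_cons_of_pos (p := fun e : Sym2 V => ∃ u v : V, e = s(u, v) ∧ ∃ X ∈ P, u ∈ X ∧ v ∉ X) _ (this.2 h), if_pos h]; simp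
  · rw [Multiset.filter_cons_of_neg (p := fun e : Sym2 V => ∃ u v : V, e = s(u, v) ∧ ∃ X ∈ P, u ∈ X ∧ v ∉ X) _ (fun h' => h (this.1 h')), if_neg h]; simp

lemma sum_ind_one (P : Finset (Finset V)) (hP : IsSubpartition P) (q : Finset V → Prop)
    [DecidablePred q] [Decidable (∃ X ∈ P, q X)] (v : V)
    (hq : ∀ X ∈ P, q X → v ∈ X) :
    ∑ X ∈ P, (if q X then 1 else 0 : ℕ) = if ∃ X ∈ P, q X then 1 else 0 := by
  split_ifs with h
  · obtain ⟨X, hX, hqX⟩ := h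
    rw [Finset.sum_eq_single X]
    · simp [hqX]
    · intro Y hY hne
      rw [if_neg]
      intro hqY
      exact Finset.disjoint_left.1 (hP.2 hY hX hne) (hq Y hY hqY) (hq X hX hqX)
    · intro h; exact absurd hX h
  · apply Finset.sum_eq_zero
    intro X hX
    rw [if_neg]
    intro hq; exact h ⟨X, hX, hq⟩

lemma eCross_eq (E : Multiset (Sym2 V)) (P : Finset (Finset V)) (hP : IsSubpartition P) :
    eCross E P + ∑ X ∈ P, insE E X = touchE E (P.sup id) := by
  induction E using Multiset.induction_on with
  | empty => simp [eCross_zero, insE_zero, touchE_zero]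
  | cons e E ih =>
    induction e using Sym2.ind with
    | _ u v =>
    rw [eCross_cons, touchE_cons, ← ih]
    simp only [insE_cons]
    rw [Finset.sum_add_distrib, sum_ind_one P hP (fun X => u ∈ X ∧ v ∈ X) u (fun X _ h => h.1)]
    have key : ((if (∃ X ∈ P, u ∈ X ∧ v ∉ X) ∨ (∃ X ∈ P, v ∈ X ∧ u ∉ X) then 1 else 0) +
      (if ∃ X ∈ P, u ∈ X ∧ v ∈ X then 1 else 0) : ℕ) =
      if u ∈ P.sup id ∨ v ∈ P.sup id then 1 else 0 := by
      simp only [mem_supid]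
      have excl : (∃ X ∈ P, u ∈ X ∧ v ∈ X) →
          ¬ ((∃ X ∈ P, u ∈ X ∧ v ∉ X) ∨ (∃ X ∈ P, v ∈ X ∧ u ∉ X)) := by
        rintro ⟨X, hX, hu, hv⟩ (⟨Y, hY, h1, h2⟩ | ⟨Y, hY, h1, h2⟩)
        · have : X ≠ Y := by rintro rfl; exact h2 hv
          exact Finset.disjoint_left.1 (hP.2 hX hY this) hu h1
        · have : X ≠ Y := by rintro rfl; exact h2 hu
          exact Finset.disjoint_left.1 (hP.2 hX hY this) hv h1
      by_cases hin : ∃ X ∈ P, u ∈ X ∧ v ∈ X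
      · rw [if_pos hin, if_neg (excl hin), if_pos]
        obtain ⟨X, hX, hu, hv⟩ := hin
        exact Or.inl ⟨X, hX, hu⟩
      · rw [if_neg hin]
        have : ((∃ X ∈ P, u ∈ X ∧ v ∉ X) ∨ (∃ X ∈ P, v ∈ X ∧ u ∉ X)) ↔
            ((∃ X ∈ P, u ∈ X) ∨ (∃ X ∈ P, v ∈ X)) := by
          constructor
          · rintro (⟨X, hX, h, _⟩ | ⟨X, hX, h, _⟩)
            · exact Or.inl ⟨X, hX, h⟩
            · exact Or.inr ⟨X, hX, h⟩
          · rintro (⟨X, hX, h⟩ | ⟨X, hX, h⟩)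
            · exact Or.inl ⟨X, hX, h, fun h' => hin ⟨X, hX, h, h'⟩⟩
            · exact Or.inr ⟨X, hX, h, fun h' => hin ⟨X, hX, h', h⟩⟩
        simp only [this, add_zero]
    omega

lemma insE_supermod (E : Multiset (Sym2 V)) (X Y : Finset V) :
    insE E X + insE E Y ≤ insE E (X ∪ Y) + insE E (X ∩ Y) := by
  induction E using Multiset.induction_on with
  | empty => simp [insE_zero]
  | cons e E ih =>
    induction e using Sym2.ind with
    | _ u v =>
    simp only [insE_cons, Finset.mem_union, Finset.mem_inter]
    by_cases h1 : u ∈ X <;> by_cases h2 : v ∈ X <;> by_cases h3 : u ∈ Y <;>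
      by_cases h4 : v ∈ Y <;> simp [h1, h2, h3, h4] <;> omega

lemma touchE_submod (E : Multiset (Sym2 V)) (X Y : Finset V) :
    touchE E (X ∪ Y) + touchE E (X ∩ Y) ≤ touchE E X + touchE E Y := by
  induction E using Multiset.induction_on with
  | empty => simp [touchE_zero]
  | cons e E ih =>
    induction e using Sym2.ind with
    | _ u v =>
    simp only [touchE_cons, Finset.mem_union, Finset.mem_inter]
    by_cases h1 : u ∈ X <;> by_cases h2 : v ∈ X <;> by_cases h3 : u ∈ Y <;>
      by_cases h4 : v ∈ Y <;> simp [h1, h2, h3, h4] <;> omega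

/-- the intersecting supermodular function -/
noncomputable def bFun (k : ℤ) (E : Multiset (Sym2 V)) (A : Multiset (V × V)) (X : Finset V) : ℤ :=
  k - dIn A X + insE E X

lemma bFun_supermod (k : ℤ) (E : Multiset (Sym2 V)) (A : Multiset (V × V)) (X Y : Finset V) :
    bFun k E A X + bFun k E A Y ≤ bFun k E A (X ∪ Y) + bFun k E A (X ∩ Y) := by
  unfold bFun
  have := dIn_submod A X Y
  have := insE_supermod E X Y
  omega

lemma sum_bFun (k : ℤ) (E : Multiset (Sym2 V)) (A : Multiset (V × V)) (P : Finset (Finset V))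
    (hP : IsSubpartition P) :
    ∑ X ∈ P, bFun k E A X = k * P.card - ∑ X ∈ P, (dIn A X : ℤ) + touchE E (P.sup id)
      - eCross E P := by
  have := eCross_eq E P hP
  unfold bFun
  rw [Finset.sum_add_distrib, Finset.sum_sub_distrib, ← this]
  push_cast
  simp
  ring

lemma sum_ind_int (P : Finset (Finset V)) (hP : IsSubpartition P) (v : V) :
    ∑ X ∈ P, (if v ∈ X then 1 else 0 : ℤ) = if v ∈ P.sup id then 1 else 0 := by
  have := sum_ind_one P hP (fun X => v ∈ X) v (fun _ _ h => h)
  simp only [mem_supid]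
  exact_mod_cast this

lemma bFun_orient (k : ℤ) (E : Multiset (Sym2 V)) (A : Multiset (V × V)) (u v : V)
    (X : Finset V) :
    bFun k E ((u, v) ::ₘ A) X = bFun k (s(u, v) ::ₘ E) A X - if v ∈ X then 1 else 0 := by
  unfold bFun
  rw [dIn_cons, insE_cons]
  by_cases h1 : u ∈ X <;> by_cases h2 : v ∈ X <;> simp [h1, h2] <;> ring

lemma sum_bFun_orient (k : ℤ) (E : Multiset (Sym2 V)) (A : Multiset (V × V)) (u v : V)
    (P : Finset (Finset V)) (hP : IsSubpartition P) :
    ∑ X ∈ P, bFun k E ((u, v) ::ₘ A) X =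
      ∑ X ∈ P, bFun k (s(u, v) ::ₘ E) A X - if v ∈ P.sup id then 1 else 0 := by
  simp only [bFun_orient]
  rw [Finset.sum_sub_distrib, sum_ind_int P hP]

lemma orient (k : ℤ) (m : V → ℤ) (E : Multiset (Sym2 V)) :
    ∀ (A : Multiset (V × V)),
    (∀ P, IsSubpartition P → ∑ X ∈ P, bFun k E A X ≤ touchE E (P.sup id) + ∑ v ∈ P.sup id, m v) →
    ∃ O : Multiset (V × V), O.map (fun p => s(p.1, p.2)) = E ∧
      ∀ X : Finset V, X.Nonempty → k ≤ dIn (A + O) X + ∑ v ∈ X, m v := by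
  induction E using Multiset.induction_on with
  | empty =>
    intro A h
    refine ⟨0, by simp, fun X hX => ?_⟩
    have := h {X} ⟨by simpa using hX, by simp⟩
    simp [bFun, insE_zero, touchE_zero] at this
    simp
    linarith
  | cons e E ih =>
    induction e using Sym2.ind with
    | _ u v =>
    intro A h
    by_cases h1 : ∀ P, IsSubpartition P → ∑ X ∈ P, bFun k E ((u, v) ::ₘ A) X ≤
        touchE E (P.sup id) + ∑ v ∈ P.sup id, m v
    · obtain ⟨O, hO, h2⟩ := ih _ h1
      refine ⟨(u, v) ::ₘ O, by simp [hO], fun X hX => ?_⟩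
      have := h2 X hX
      rwa [Multiset.cons_add, ← Multiset.add_cons] at this
    by_cases h1' : ∀ P, IsSubpartition P → ∑ X ∈ P, bFun k E ((v, u) ::ₘ A) X ≤
        touchE E (P.sup id) + ∑ v ∈ P.sup id, m v
    · obtain ⟨O, hO, h2⟩ := ih _ h1'
      refine ⟨(v, u) ::ₘ O, by simp [hO, Sym2.eq_swap], fun X hX => ?_⟩
      have := h2 X hX
      rwa [Multiset.cons_add, ← Multiset.add_cons] at this
    exfalso
    push Not at h1 h1'
    obtain ⟨P, hP, hPl⟩ := h1
    obtain ⟨Q, hQ, hQl⟩ := h1'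
    rw [sum_bFun_orient k E A u v P hP] at hPl
    rw [sum_bFun_orient k E A v u Q hQ, Sym2.eq_swap] at hQl
    have a1 := h P hP
    have a2 := h Q hQ
    obtain ⟨P', Q', hP', hQ', e1, e2, hle⟩ :=
      uncross3 _ (fun X Y _ => bFun_supermod k (s(u, v) ::ₘ E) A X Y) Q P hQ hP
    have a3 := h P' hP'
    have a4 := h Q' hQ'
    rw [e1] at a3
    rw [e2] at a4
    have a5 := touchE_submod E (P.sup id) (Q.sup id)
    have a6 := Finset.sum_union_inter (s₁ := P.sup id) (s₂ := Q.sup id) (f := m)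
    rw [touchE_cons] at a1 a2 a3 a4
    generalize P.sup id = Z at *
    generalize Q.sup id = W at *
    simp only [Finset.mem_union, Finset.mem_inter] at a3 a4
    by_cases h1 : u ∈ Z <;> by_cases h2 : v ∈ Z <;> by_cases h3 : u ∈ W <;>
      by_cases h4 : v ∈ W <;> simp [h1, h2, h3, h4] at * <;> omega

end Graph

section Edmonds
variable {V : Type*} [DecidableEq V]

lemma exists_arc_of_dIn_lt (A : Multiset (V × V)) (X Y : Finset V) (h : dIn A X < dIn A Y) :
    ∃ p ∈ A, (p.2 ∈ Y ∧ p.1 ∉ Y) ∧ ¬ (p.2 ∈ X ∧ p.1 ∉ X) := by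
  by_contra hcon
  push Not at hcon
  apply absurd h
  rw [not_lt]
  apply Multiset.card_le_card
  rw [Multiset.le_filter]
  refine ⟨Multiset.filter_le _ _, fun p hp => ?_⟩
  rw [Multiset.mem_filter] at hp
  exact hcon p hp.1 hp.2

lemma find_arc [Fintype V] (K : ℤ) (m : V → ℤ) (hm : ∀ v, 0 ≤ m v) (hK : ∑ v, m v ≤ K)
    (S : Finset V) (A : Multiset (V × V)) (hS : (Finset.univ \ S).Nonempty)
    (hA : ∀ X : Finset V, X.Nonempty →
      K - ∑ v ∈ X, m v + (if Disjoint S X then 1 else 0) ≤ dIn A X) :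
    ∃ a ∈ S, ∃ b, b ∉ S ∧ (a, b) ∈ A ∧
      ∀ Y : Finset V, b ∈ Y → a ∉ Y → ¬ Disjoint S Y → K - ∑ v ∈ Y, m v < dIn A Y := by
  have hnn : ∀ X : Finset V, 0 ≤ K - ∑ v ∈ X, m v := by
    intro X
    have : ∑ v ∈ X, m v ≤ ∑ v, m v :=
      Finset.sum_le_sum_of_subset_of_nonneg (Finset.subset_univ _) (fun v _ _ => hm v)
    linarith
  set C := (Finset.univ : Finset (Finset V)).filter (fun X =>
    ¬ Disjoint S X ∧ (X \ S).Nonempty ∧ (dIn A X : ℤ) = K - ∑ v ∈ X, m v) with hC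
  by_cases hne : C.Nonempty
  · obtain ⟨X, hX, hmin⟩ := Finset.exists_min_image C Finset.card hne
    obtain ⟨hX1, hX2, hX3⟩ := (Finset.mem_filter.1 hX).2
    have h1 := hA (X \ S) hX2
    rw [if_pos Finset.disjoint_sdiff] at h1
    have h2 : ∑ v ∈ X \ S, m v ≤ ∑ v ∈ X, m v :=
      Finset.sum_le_sum_of_subset_of_nonneg Finset.sdiff_subset (fun v _ _ => hm v)
    obtain ⟨⟨a, b⟩, hp, ⟨hp1, hp2⟩, hp3⟩ := exists_arc_of_dIn_lt A X (X \ S) (by omega)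
    simp only [Finset.mem_sdiff] at hp1 hp2 hp3
    have haX : a ∈ X := by tauto
    have haS : a ∈ S := by tauto
    refine ⟨a, haS, b, hp1.2, hp, fun Y hbY haY hSY => ?_⟩
    by_contra hlt
    have hXYn : (X ∩ Y).Nonempty := ⟨b, Finset.mem_inter.2 ⟨hp1.1, hbY⟩⟩
    have h3 := hA (X ∩ Y) hXYn
    have h4 := hA (X ∪ Y) ⟨b, Finset.mem_union_left _ hp1.1⟩
    have h5 := dIn_submod A X Y
    have h6 := Finset.sum_union_inter (s₁ := X) (s₂ := Y) (f := m)
    have h7 : (0 : ℤ) ≤ if Disjoint S (X ∪ Y) then 1 else 0 := by split_ifs <;> simp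
    have hnd : ¬ Disjoint S (X ∩ Y) := by
      intro hd
      rw [if_pos hd] at h3
      omega
    rw [if_neg hnd] at h3
    have hmem : X ∩ Y ∈ C := by
      rw [hC, Finset.mem_filter]
      refine ⟨Finset.mem_univ _, hnd, ⟨b, ?_⟩, by omega⟩
      simp [hp1, hbY]
    have hlt2 : (X ∩ Y).card < X.card := by
      apply Finset.card_lt_card
      refine ⟨Finset.inter_subset_left, fun hsub => haY ?_⟩
      exact (Finset.mem_inter.1 (hsub haX)).2
    exact absurd (hmin _ hmem) (by omega)
  · have h1 := hA (Finset.univ \ S) hS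
    rw [if_pos Finset.disjoint_sdiff] at h1
    have h0 := hnn (Finset.univ \ S)
    obtain ⟨⟨a, b⟩, hp, ⟨hp1, hp2⟩, -⟩ :=
      exists_arc_of_dIn_lt A ∅ (Finset.univ \ S) (by
        have : dIn A ∅ = 0 := by simp [dIn]
        omega)
    simp only [Finset.mem_sdiff, Finset.mem_univ, true_and, not_not] at hp1 hp2
    refine ⟨a, hp2, b, hp1, hp, fun Y hbY haY hSY => ?_⟩
    have h3 := hA Y ⟨b, hbY⟩
    rw [if_neg hSY] at h3
    apply lt_of_le_of_ne (by linarith)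
    intro heq
    apply hne
    refine ⟨Y, Finset.mem_filter.2 ⟨Finset.mem_univ _, hSY, ⟨b, by simp [hp1, hbY]⟩, heq.symm⟩⟩

lemma grow [Fintype V] (K : ℤ) (m : V → ℤ) (hm : ∀ v, 0 ≤ m v) (hK : ∑ v, m v ≤ K) (r : V)
    (n : ℕ) : ∀ (S : Finset V) (B A : Multiset (V × V)), r ∈ S → (Finset.univ \ S).card = n →
    (∀ v ∈ S, Relation.ReflTransGen (fun a b : V => (a, b) ∈ B) r v) →
    (∀ p ∈ B, p.2 ∈ S ∧ p.2 ≠ r) →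
    (∀ v ∈ S, v ≠ r → (B.filter (fun p => p.2 = v)).card = 1) →
    (∀ X : Finset V, X.Nonempty →
      K - ∑ v ∈ X, m v + (if Disjoint S X then 1 else 0) ≤ dIn A X) →
    ∃ B', IsSpanningArborescence r (B + B') ∧ B' ≤ A ∧
      ∀ X : Finset V, X.Nonempty → K - ∑ v ∈ X, m v ≤ dIn (A - B') X := by
  induction n with
  | zero =>
    intro S B A hr hS h1 h2 h3 hA
    have hall : ∀ v, v ∈ S := by
      intro v
      by_contra hv
      have : v ∈ Finset.univ \ S := by simp [hv]
      rw [Finset.card_eq_zero.1 hS] at this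
      simp at this
    refine ⟨0, ⟨?_, ?_, ?_⟩, by simp, ?_⟩
    · intro v; simpa using h1 v (hall v)
    · intro p hp; exact (h2 p (by simpa using hp)).2
    · intro v hv; simpa using h3 v (hall v) hv
    · intro X hX
      have := hA X hX
      rw [if_neg] at this
      · simpa using this
      · rw [Finset.not_disjoint_iff]
        obtain ⟨v, hv⟩ := hX
        exact ⟨v, hall v, hv⟩
  | succ n ih =>
    intro S B A hr hS h1 h2 h3 hA
    obtain ⟨a, haS, b, hbS, hab, hok⟩ := find_arc K m hm hK S A
      (Finset.card_pos.1 (by omega)) hA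
    have hbr : b ≠ r := by rintro rfl; exact hbS hr
    obtain ⟨A1, rfl⟩ := Multiset.exists_cons_of_mem hab
    obtain ⟨B', hB1, hB2, hB3⟩ := ih (insert b S) ((a, b) ::ₘ B) A1 (by simp [hr])
      (by
        have : Finset.univ \ insert b S = (Finset.univ \ S).erase b := by
          ext v; simp
        rw [this, Finset.card_erase_of_mem (by simp [hbS]), hS]; rfl)
      (by
        have hmono : ∀ v ∈ S, Relation.ReflTransGen (fun x y : V => (x, y) ∈ (a, b) ::ₘ B) r v :=
          fun v hv => Relation.ReflTransGen.mono (fun x y h => Multiset.mem_cons_of_mem h) _ _ (h1 v hv)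
        intro v hv
        rcases Finset.mem_insert.1 hv with rfl | hv
        · exact (hmono a haS).tail (by simp)
        · exact hmono v hv)
      (by
        intro p hp
        rcases Multiset.mem_cons.1 hp with rfl | hp
        · exact ⟨by simp, hbr⟩
        · exact ⟨by simp [(h2 p hp).1], (h2 p hp).2⟩)
      (by
        intro v hv hvr
        rcases Finset.mem_insert.1 hv with rfl | hv
        · rw [Multiset.filter_cons_of_pos _ (by rfl)]
          have : B.filter (fun p => p.2 = v) = 0 := by
            rw [Multiset.filter_eq_nil]
            intro p hp he
            apply hbS
            rw [← he]
            exact (h2 p hp).1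
          rw [this]; simp
        · rw [Multiset.filter_cons_of_neg]
          · exact h3 v hv hvr
          · show ¬ b = v
            rintro rfl; exact hbS hv)
      (by
        intro X hX
        have hAX := hA X hX
        rw [dIn_cons] at hAX
        have hokX := hok X
        rw [dIn_cons] at hokX
        by_cases hbX : b ∈ X
        · have : ¬ Disjoint (insert b S) X := by
            rw [Finset.not_disjoint_iff]; exact ⟨b, by simp, hbX⟩
          rw [if_neg this]
          by_cases haX : a ∈ X
          · have h8 : (0 : ℤ) ≤ if Disjoint S X then 1 else 0 := by split_ifs <;> simp
            simp [haX, hbX] at hAX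
            linarith
          · by_cases hd : Disjoint S X
            · simp [haX, hbX, hd] at hAX
              linarith
            · have := hokX hbX haX hd
              simp [haX, hbX] at this
              omega
        · have : Disjoint (insert b S) X ↔ Disjoint S X := by
            rw [Finset.disjoint_insert_left]; tauto
          simp only [this]
          simp [hbX] at hAX
          simpa using hAX)
    refine ⟨(a, b) ::ₘ B', ?_, ?_, ?_⟩
    · rwa [Multiset.cons_add, ← Multiset.add_cons] at hB1
    · exact Multiset.cons_le_cons _ hB2
    · intro X hX
      have := hB3 X hX
      rwa [Multiset.sub_cons, Multiset.erase_cons_head]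

lemma sum_fiber_card {k : ℕ} (r : Fin k → V) (X : Finset V) :
    ∑ v ∈ X, (Finset.univ.filter (fun i => r i = v)).card =
      (Finset.univ.filter (fun i => r i ∈ X)).card := by
  simp only [Finset.card_filter]
  rw [Finset.sum_comm]
  simp

lemma edmonds [Fintype V] (k : ℕ) : ∀ (r : Fin k → V) (A : Multiset (V × V)),
    (∀ X : Finset V, X.Nonempty →
      k ≤ dIn A X + (Finset.univ.filter (fun i => r i ∈ X)).card) →
    ∃ B : Fin k → Multiset (V × V), ∑ i, B i ≤ A ∧ ∀ i, IsSpanningArborescence (r i) (B i) := by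
  induction k with
  | zero => intro r A _; exact ⟨fun _ => 0, by simp, fun i => i.elim0⟩
  | succ k ih =>
    intro r A h
    have hsum : ∀ X : Finset V,
        ∑ v ∈ X, ((Finset.univ.filter (fun i : Fin k => r i.succ = v)).card : ℤ) =
        (Finset.univ.filter (fun i : Fin k => r i.succ ∈ X)).card := by
      intro X
      exact_mod_cast sum_fiber_card (fun i : Fin k => r i.succ) X
    obtain ⟨B', hB1, hB2, hB3⟩ := grow (k : ℤ)
      (fun v => ((Finset.univ.filter (fun i : Fin k => r i.succ = v)).card : ℤ))
      (fun v => by positivity) (by rw [hsum]; simp) (r 0) _ {r 0} 0 A (by simp) rfl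
      (by intro v hv; rw [Finset.mem_singleton.1 hv])
      (by simp) (by intro v hv hne; exact absurd (Finset.mem_singleton.1 hv) hne)
      (by
        intro X hX
        have := h X hX
        rw [Finset.card_filter, Fin.sum_univ_succ, ← Finset.card_filter] at this
        rw [hsum]
        by_cases h0 : r 0 ∈ X <;> simp [h0] at this ⊢ <;> omega)
    rw [zero_add] at hB1
    obtain ⟨B, hB4, hB5⟩ := ih (fun i => r i.succ) (A - B') (by
      intro X hX
      have := hB3 X hX
      rw [hsum] at this
      omega)
    refine ⟨Fin.cons B' B, ?_, ?_⟩
    · rw [Fin.sum_univ_succ]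
      simp only [Fin.cons_zero, Fin.cons_succ]
      calc B' + ∑ i, B i ≤ B' + (A - B') := by gcongr
        _ = A := add_tsub_cancel_of_le hB2
    · intro i
      refine Fin.cases ?_ ?_ i
      · simpa using hB1
      · intro j; simpa using hB5 j

lemma split_sum {α : Type*} [DecidableEq α] (k : ℕ) : ∀ (B : Fin k → Multiset α) (A O : Multiset α),
    ∑ i, B i ≤ A + O → ∃ AA OO : Fin k → Multiset α, (∀ i, AA i + OO i = B i) ∧
      ∑ i, AA i ≤ A ∧ ∑ i, OO i ≤ O := by
  induction k with
  | zero => intro B A O _; exact ⟨B, B, fun i => i.elim0, by simp, by simp⟩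
  | succ k ih =>
    intro B A O h
    rw [Fin.sum_univ_succ, Multiset.le_iff_count] at h
    obtain ⟨AA, OO, h1, h2, h3⟩ := ih (fun i => B i.succ) (A - B 0 ∩ A) (O - (B 0 - A)) (by
      rw [Multiset.le_iff_count]
      intro x
      have := h x
      simp only [Multiset.count_add, Multiset.count_sub, Multiset.count_inter] at this ⊢
      omega)
    refine ⟨Fin.cons (B 0 ∩ A) AA, Fin.cons (B 0 - A) OO, ?_, ?_, ?_⟩
    · intro i
      refine Fin.cases ?_ ?_ i
      · ext x
        simp only [Fin.cons_zero, Multiset.count_add, Multiset.count_sub, Multiset.count_inter]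
        omega
      · intro j; simpa using h1 j
    · rw [Fin.sum_univ_succ]
      simp only [Fin.cons_zero, Fin.cons_succ]
      rw [Multiset.le_iff_count] at h2 ⊢
      intro x
      have := h2 x
      have := h x
      simp only [Multiset.count_add, Multiset.count_sub, Multiset.count_inter] at *
      omega
    · rw [Fin.sum_univ_succ]
      simp only [Fin.cons_zero, Fin.cons_succ]
      rw [Multiset.le_iff_count] at h3 ⊢
      intro x
      have := h3 x
      have := h x
      simp only [Multiset.count_add, Multiset.count_sub, Multiset.count_inter] at *
      omega

lemma exists_roots [Fintype V] (k : ℕ) (n : V → ℕ) (hn : ∑ v, n v = k) :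
    ∃ r : Fin k → V, ∀ v, (Finset.univ.filter (fun i => r i = v)).card = n v := by
  have hc : Fintype.card (Fin k) = Fintype.card (Σ v, Fin (n v)) := by simp [hn]
  let e := Fintype.equivOfCardEq hc
  refine ⟨fun i => (e i).1, fun v => ?_⟩
  rw [Finset.card_filter, Equiv.sum_comp e (fun x => if x.1 = v then 1 else 0),
    Fintype.sum_sigma, Finset.sum_eq_single v]
  · simp
  · intro w _ hw; simp [hw]
  · simp

lemma dIn_sum {k : ℕ} (B : Fin k → Multiset (V × V)) (X : Finset V) :
    dIn (∑ i, B i) X = ∑ i, dIn (B i) X := by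
  induction k with
  | zero => simp [dIn_zero]
  | succ k ih => rw [Fin.sum_univ_succ, Fin.sum_univ_succ, dIn_add, ih]

lemma arb_enter (r : V) (B : Multiset (V × V)) (h : IsSpanningArborescence r B) (X : Finset V)
    (hX : X.Nonempty) (hr : r ∉ X) : 1 ≤ dIn B X := by
  by_contra hcon
  have h0 : dIn B X = 0 := by omega
  unfold dIn at h0
  rw [Multiset.card_eq_zero, Multiset.filter_eq_nil] at h0
  have : ∀ w, Relation.ReflTransGen (fun a b : V => (a, b) ∈ B) r w → w ∉ X := by
    intro w hw
    induction hw with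
    | refl => exact hr
    | tail _ h2 ih => exact fun hc => h0 _ h2 ⟨hc, ih⟩
  obtain ⟨v, hv⟩ := hX
  exact this v (h.1 v) hv

lemma sum_dIn_le_eCross (O : Multiset (V × V)) (P : Finset (Finset V)) (hP : IsSubpartition P) :
    ∑ X ∈ P, dIn O X ≤ eCross (O.map (fun p => s(p.1, p.2))) P := by
  induction O using Multiset.induction_on with
  | empty => simp [dIn_zero]
  | cons p O ih =>
    simp only [dIn_cons, Multiset.map_cons]
    rw [eCross_cons, Finset.sum_add_distrib,
      sum_ind_one P hP (fun X => p.2 ∈ X ∧ p.1 ∉ X) p.2 (fun X _ h => h.1)]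
    apply add_le_add ih
    by_cases h : ∃ X ∈ P, p.2 ∈ X ∧ p.1 ∉ X
    · rw [if_pos h, if_pos (Or.inr h)]
    · rw [if_neg h]; simp

lemma eCross_mono {E E' : Multiset (Sym2 V)} (h : E ≤ E') (P : Finset (Finset V)) :
    eCross E P ≤ eCross E' P :=
  Multiset.card_le_card (Multiset.filter_le_filter _ h)

lemma packing_bound {k : ℕ} (E : Multiset (Sym2 V)) (A : Multiset (V × V)) (r : Fin k → V)
    (EA : Fin k → Multiset (Sym2 V)) (AA : Fin k → Multiset (V × V))
    (hE : ∑ i, EA i ≤ E) (hA : ∑ i, AA i ≤ A)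
    (h : ∀ i, IsSpanningMixedArborescence (r i) (EA i) (AA i))
    (P : Finset (Finset V)) (hP : IsSubpartition P) :
    k * P.card ≤ eCross E P + ∑ X ∈ P, dIn A X +
      (Finset.univ.filter (fun i => r i ∈ P.sup id)).card := by
  choose O hO hB using h
  have hmap : (∑ i, O i).map (fun p => s(p.1, p.2)) = ∑ i, EA i := by
    have := map_sum (Multiset.mapAddMonoidHom (fun p : V × V => s(p.1, p.2))) O Finset.univ
    simp only [Multiset.coe_mapAddMonoidHom] at this
    rw [this]
    exact Finset.sum_congr rfl (fun i _ => hO i)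
  have h1 := sum_dIn_le_eCross (∑ i, O i) P hP
  rw [hmap] at h1
  have h2 := eCross_mono hE P
  have h3 : ∑ X ∈ P, dIn (∑ i, AA i) X ≤ ∑ X ∈ P, dIn A X :=
    Finset.sum_le_sum (fun X _ => dIn_mono hA X)
  have h4 : ∑ X ∈ P, ∑ _i : Fin k, 1 ≤ ∑ X ∈ P, ∑ i, (dIn (AA i + O i) X + if r i ∈ X then 1 else 0) := by
    apply Finset.sum_le_sum; intro X hX
    apply Finset.sum_le_sum; intro i _
    by_cases hr : r i ∈ X
    · simp [hr]
    · have := arb_enter _ _ (hB i) X (hP.1 X hX) hr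
      omega
  have h5 : ∑ X ∈ P, ∑ i, (if r i ∈ X then 1 else 0) =
      (Finset.univ.filter (fun i => r i ∈ P.sup id)).card := by
    rw [Finset.sum_comm, Finset.card_filter]
    apply Finset.sum_congr rfl
    intro i _
    have := sum_ind_one P hP (fun X => r i ∈ X) (r i) (fun _ _ h => h)
    rw [this]
    simp only [mem_supid]
  simp only [dIn_add, Finset.sum_add_distrib, ← dIn_sum] at h4
  rw [h5] at h4
  simp only [Finset.sum_const, Finset.card_univ, Fintype.card_fin, smul_eq_mul, mul_one] at h4
  rw [mul_comm] at h4
  omega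

end Edmonds

/-- **Packing of spanning mixed arborescences** (Gao–Yang).  A loopless mixed
graph `F = (V; E, A)` contains `k` edge- and arc-disjoint spanning mixed
arborescences whose root multiplicities lie between `f` and `g` if and only if
(i) `f̃(V) ≤ k`, and for every subpartition `P = {X₁, …, X_t}` of `V`,
(ii) `e_E(P) + ∑ d_A^-(X_j) ≥ k(t-1) + f̃(V ∖ ∪ X_j)` and
(iii) `e_E(P) + ∑ d_A^-(X_j) ≥ kt − g̃(∪ X_j)`. -/
theorem mixed_arborescence_packing
    {V : Type*} [Fintype V] [DecidableEq V] [Nonempty V]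
    (E : Multiset (Sym2 V)) (A : Multiset (V × V))
    (hE : ∀ e ∈ E, ¬ e.IsDiag) (hA : ∀ p ∈ A, p.1 ≠ p.2)
    (k : ℕ) (f g : V → ℕ) (hfg : ∀ v : V, f v ≤ g v) :
    (∃ (r : Fin k → V) (EA : Fin k → Multiset (Sym2 V))
        (AA : Fin k → Multiset (V × V)),
        (∑ i, EA i) ≤ E ∧ (∑ i, AA i) ≤ A ∧
        (∀ i, IsSpanningMixedArborescence (r i) (EA i) (AA i)) ∧
        (∀ v : V, f v ≤ (Finset.univ.filter (fun i => r i = v)).card ∧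
          (Finset.univ.filter (fun i => r i = v)).card ≤ g v)) ↔
      ((∑ v : V, f v) ≤ k ∧
       (∀ P : Finset (Finset V), IsSubpartition P →
         (eCross E P : ℤ) + ∑ X ∈ P, (dIn A X : ℤ) ≥
           (k : ℤ) * ((P.card : ℤ) - 1) + ∑ v ∈ Finset.univ \ P.sup id, (f v : ℤ)) ∧
       (∀ P : Finset (Finset V), IsSubpartition P →
         (eCross E P : ℤ) + ∑ X ∈ P, (dIn A X : ℤ) ≥
           (k : ℤ) * (P.card : ℤ) - ∑ v ∈ P.sup id, (g v : ℤ))) := by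
  constructor
  · rintro ⟨r, EA, AA, hEA, hAA, harb, hroot⟩
    have hcnt := sum_fiber_card r
    have htot : ∑ v, (Finset.univ.filter (fun i => r i = v)).card = k := by
      rw [hcnt]; simp
    refine ⟨?_, ?_, ?_⟩
    · calc ∑ v, f v ≤ ∑ v, (Finset.univ.filter (fun i => r i = v)).card :=
            Finset.sum_le_sum (fun v _ => (hroot v).1)
        _ = k := htot
    · intro P hP
      have hb := packing_bound E A r EA AA hEA hAA harb P hP
      rw [← hcnt] at hb
      have h1 : ∑ v ∈ Finset.univ \ P.sup id, f v ≤
          ∑ v ∈ Finset.univ \ P.sup id, (Finset.univ.filter (fun i => r i = v)).card :=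
        Finset.sum_le_sum (fun v _ => (hroot v).1)
      have h2 := Finset.sum_sdiff (Finset.subset_univ (P.sup id))
        (f := fun v => (Finset.univ.filter (fun i => r i = v)).card)
      rw [htot] at h2
      zify at hb h1 h2
      linarith
    · intro P hP
      have hb := packing_bound E A r EA AA hEA hAA harb P hP
      rw [← hcnt] at hb
      have h1 : ∑ v ∈ P.sup id, (Finset.univ.filter (fun i => r i = v)).card ≤
          ∑ v ∈ P.sup id, g v :=
        Finset.sum_le_sum (fun v _ => (hroot v).2)
      zify at hb h1
      linarith
  · rintro ⟨-, h2, h3⟩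
    have hnn : 0 ≤ ∑ v, ((g v : ℤ) - f v) :=
      Finset.sum_nonneg (fun v _ => by have := hfg v; omega)
    obtain ⟨n, hn⟩ := Int.eq_ofNat_of_zero_le hnn
    obtain ⟨m, hm, hm1, hm2⟩ := choose_roots (bFun k E A) (fun Z => (touchE E Z : ℤ)) k
      (fun X Y _ => bFun_supermod k E A X Y)
      (fun X Y => by exact_mod_cast touchE_submod E X Y) n (fun v => f v) (fun v => g v)
      (fun v => by exact_mod_cast hfg v) hn
      (fun P hP => by
        have := h2 P hP
        rw [sum_bFun k E A P hP]
        linarith)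
      (fun P hP => by
        have := h3 P hP
        rw [sum_bFun k E A P hP]
        linarith)
    have hm0 : ∀ v, 0 ≤ m v := fun v => le_trans (by positivity) (hm v).1
    obtain ⟨O, hO, hdeg⟩ := orient (k : ℤ) m E A hm2
    have hmk : ∑ v, m v = k := by
      apply le_antisymm
      · have := hm1 ∅ ⟨by simp, by simp⟩
        simp [touchE] at this
        exact this
      · have := hdeg Finset.univ Finset.univ_nonempty
        simpa [dIn] using this
    have hmn : ∀ v, ((m v).toNat : ℤ) = m v := fun v => Int.toNat_of_nonneg (hm0 v)
    obtain ⟨r, hr⟩ := exists_roots k (fun v => (m v).toNat) (by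
      zify
      rw [← hmk]
      exact Finset.sum_congr rfl (fun v _ => hmn v))
    obtain ⟨B, hB1, hB2⟩ := edmonds k r (A + O) (by
      intro X hX
      have := hdeg X hX
      rw [← sum_fiber_card]
      simp only [hr]
      zify
      simp only [hmn]
      exact this)
    obtain ⟨AA, OO, hs1, hs2, hs3⟩ := split_sum k B A O hB1
    refine ⟨r, fun i => (OO i).map (fun p => s(p.1, p.2)), AA, ?_, hs2, ?_, ?_⟩
    · have := map_sum (Multiset.mapAddMonoidHom (fun p : V × V => s(p.1, p.2))) OO Finset.univ
      simp only [Multiset.coe_mapAddMonoidHom] at this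
      rw [← this, ← hO]
      exact Multiset.map_le_map hs3
    · intro i
      refine ⟨OO i, rfl, ?_⟩
      rw [hs1 i]
      exact hB2 i
    · intro v
      rw [hr v]
      have := hm v
      have := hmn v
      omega
end

section
/- Let G = (V, E) be a finite undirected multigraph. G contains k edge-disjoint spanning trees if and only if for every partition P = {X₀, X₁, …, X_t} of V into nonempty parts, the number of edges joining distinct parts is at least kt. -/
open scoped Classical

/-- `T` is a spanning tree of a multigraph on the vertex type `V`: any two
vertices are joined by a walk in `T`, and `T` has `|V| - 1` edges. -/
def IsSpanningTree {V : Type*} [Fintype V] [DecidableEq V]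
    (T : Multiset (Sym2 V)) : Prop :=
  (∀ u v : V, Relation.ReflTransGen (fun a b : V => s(a, b) ∈ T) u v) ∧
  Multiset.card T + 1 = Fintype.card V

/-- `P` is a partition of the vertex set into nonempty parts. -/
def IsPartition {V : Type*} [Fintype V] [DecidableEq V]
    (P : Finset (Finset V)) : Prop :=
  (∀ X ∈ P, X.Nonempty) ∧ (P : Set (Finset V)).Pairwise Disjoint ∧
    P.sup id = Finset.univ

/-- Matroid-union lemma for vectors (exchange argument). -/
theorem nwt_union {K W ι : Type*} [Field K] [AddCommGroup W] [Module K W] [Fintype ι]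
    (x : ι → W) (k : ℕ) :
    ∃ (c : ι → Option (Fin k)) (A : Set ι),
      (∀ i, LinearIndepOn K x {e | c e = some i}) ∧
      (∀ e, c e = none → e ∈ A) ∧
      ∀ i, ∀ e ∈ A, x e ∈ Submodule.span K (x '' {e | c e = some i ∧ e ∈ A}) := by
  classical
  let Valid : (ι → Option (Fin k)) → Prop := fun c => ∀ i, LinearIndepOn K x {e | c e = some i}
  let N : (ι → Option (Fin k)) → ℕ := fun c => (Finset.univ.filter (fun e => c e = none)).card
  have hne : ((Finset.univ : Finset (ι → Option (Fin k))).filter Valid).Nonempty := by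
    refine ⟨fun _ => none, ?_⟩
    simp [Valid]
  obtain ⟨c, hcm, hmin⟩ := Finset.exists_min_image _ N hne
  have hc : Valid c := by simpa using hcm
  replace hmin : ∀ c', Valid c' → N c ≤ N c' := fun c' h' => hmin c' (by simpa using h')
  let Step : (ι → Option (Fin k)) → (ι → Option (Fin k)) → Prop := fun c c' =>
    Valid c' ∧ ∃ e f i, c e = none ∧ c f = some i ∧
      c' = Function.update (Function.update c e (some i)) f none
  let R := Relation.ReflTransGen Step c
  let A : Set ι := {e | ∃ c', R c' ∧ c' e = none}
  have hR : ∀ c', R c' → Valid c' ∧ N c' = N c := by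
    intro c' h
    induction h with
    | refl => exact ⟨hc, rfl⟩
    | @tail b _ _ hs ih =>
      obtain ⟨hv, e, f, i, he, hf, rfl⟩ := hs
      refine ⟨hv, ?_⟩
      rw [← ih.2]
      have hef : e ≠ f := by rintro rfl; simp [he] at hf
      have : (Finset.univ.filter
          (fun a => Function.update (Function.update b e (some i)) f none a = none))
          = insert f ((Finset.univ.filter (fun a => b a = none)).erase e) := by
        ext a
        simp only [Finset.mem_filter, Finset.mem_univ, true_and, Finset.mem_insert,
          Finset.mem_erase, Function.update_apply]
        split_ifs with h1 h2 <;> simp_all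
      simp only [N, this]
      rw [Finset.card_insert_of_notMem (by simp [hf]), Finset.card_erase_of_mem (by simp [he])]
      have : 0 < (Finset.univ.filter (fun a => b a = none)).card :=
        Finset.card_pos.2 ⟨e, by simp [he]⟩
      omega
  have claim1 : ∀ c', R c' → ∀ e, c' e = none → ∀ i,
      x e ∈ Submodule.span K (x '' {e | c' e = some i ∧ e ∈ A}) := by
    intro c' h e he i
    obtain ⟨hv, hN⟩ := hR c' h
    -- first: in the span of the colour class
    have h1 : x e ∈ Submodule.span K (x '' {a | c' a = some i}) := by
      by_contra hcon
      have hV : Valid (Function.update c' e (some i)) := by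
        intro j
        by_cases hj : j = i
        · subst hj
          have : {a | Function.update c' e (some j) a = some j}
              = insert e {a | c' a = some j} := by
            ext a
            simp only [Set.mem_ofPred_eq, Set.mem_insert_iff, Function.update_apply]
            split_ifs with h1 <;> simp_all
          rw [this, linearIndepOn_insert (by simp [he])]
          exact ⟨hv j, hcon⟩
        · refine (hv j).mono ?_
          intro a
          simp only [Set.mem_ofPred_eq, Function.update_apply]
          split_ifs with h1
          · simp [Ne.symm hj]
          · exact id
      have h2 := hmin _ hV
      have : (Finset.univ.filter (fun a => Function.update c' e (some i) a = none))
          = (Finset.univ.filter (fun a => c' a = none)).erase e := by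
        ext a
        simp only [Finset.mem_filter, Finset.mem_univ, true_and,
          Finset.mem_erase, Function.update_apply]
        split_ifs with h1 <;> simp_all
      have h3 : 0 < (Finset.univ.filter (fun a => c' a = none)).card :=
        Finset.card_pos.2 ⟨e, by simp [he]⟩
      rw [← hN] at h2
      simp only [N, this] at h2
      rw [Finset.card_erase_of_mem (by simp [he])] at h2
      omega
    obtain ⟨l, hl, hlx⟩ := (Finsupp.mem_span_image_iff_linearCombination K).1 h1
    refine (Finsupp.mem_span_image_iff_linearCombination K).2 ⟨l, ?_, hlx⟩
    rw [Finsupp.mem_supported] at hl ⊢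
    intro f hf
    have hfi : c' f = some i := hl hf
    refine ⟨hfi, ?_⟩
    have hef : e ≠ f := by rintro rfl; simp [he] at hfi
    refine ⟨Function.update (Function.update c' e (some i)) f none,
      Relation.ReflTransGen.tail h ⟨?_, e, f, i, he, hfi, rfl⟩, by simp⟩
    intro j
    by_cases hj : j = i
    · subst hj
      have : {a | Function.update (Function.update c' e (some j)) f none a = some j}
          = insert e ({a | c' a = some j} \ {f}) := by
        ext a
        simp only [Set.mem_ofPred_eq, Set.mem_insert_iff, Function.update_apply, Set.mem_sdiff,
          Set.mem_singleton_iff]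
        split_ifs with h1 h2 <;> simp_all
        exact fun h => hef h.symm
      rw [this, linearIndepOn_insert (by simp [he])]
      refine ⟨(hv j).mono Set.sdiff_subset, ?_⟩
      intro hcon
      obtain ⟨l', hl', hlx'⟩ := (Finsupp.mem_span_image_iff_linearCombination K).1 hcon
      have := linearIndepOn_iffₛ.1 (hv j) l hl l'
        (Finsupp.supported_mono Set.sdiff_subset hl') (hlx.trans hlx'.symm)
      subst this
      exact (hl' hf).2 rfl
    · refine (hv j).mono ?_
      intro a
      simp only [Set.mem_ofPred_eq, Function.update_apply]
      split_ifs with h1 h2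
      · simp
      · simp [Ne.symm hj]
      · exact id
  have claim2 : ∀ c', R c' → ∀ i, Submodule.span K (x '' {e | c' e = some i ∧ e ∈ A}) ≤
      Submodule.span K (x '' {e | c e = some i ∧ e ∈ A}) := by
    intro c' h
    induction h with
    | refl => exact fun i => le_rfl
    | tail hb hs ih =>
      obtain ⟨hv, e, f, i, he, hf, rfl⟩ := hs
      intro j
      refine le_trans ?_ (ih j)
      rw [Submodule.span_le]
      rintro _ ⟨a, ⟨ha, haA⟩, rfl⟩
      by_cases hae : a = e
      · subst hae
        exact claim1 _ hb a he j
      · refine Submodule.subset_span ⟨a, ⟨?_, haA⟩, rfl⟩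
        simp only [Function.update_apply] at ha
        split_ifs at ha
        exact ha
  refine ⟨c, A, hc, fun e he => ⟨c, .refl, he⟩, ?_⟩
  rintro i e ⟨c', h, he⟩
  exact claim2 c' h i (claim1 c' h e he i)

/-- The edge `e` crosses the family `P`. -/
def nwtX {V : Type*} (P : Finset (Finset V)) (e : Sym2 V) : Prop :=
  ∃ u v : V, e = s(u, v) ∧ ∃ X ∈ P, u ∈ X ∧ v ∉ X

theorem nwt_eCross {V : Type*} [DecidableEq V] (E : Multiset (Sym2 V)) (P : Finset (Finset V)) :
    eCross E P = (E.filter (nwtX P)).card := by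
  unfold eCross
  congr 1

/-- A connected edge multiset crosses a partition at least `|P| - 1` times. -/
theorem nwt_cross_ge {V : Type*} [Fintype V] [DecidableEq V] [Nonempty V]
    (T : Multiset (Sym2 V))
    (hT : ∀ u v : V, Relation.ReflTransGen (fun a b : V => s(a, b) ∈ T) u v)
    (P : Finset (Finset V)) (hP : IsPartition P) :
    P.card ≤ eCross T P + 1 := by
  obtain ⟨hne, hdis, hsup⟩ := hP
  have hex : ∀ v : V, ∃ X : {X // X ∈ P}, v ∈ X.1 := by
    intro v
    have : v ∈ P.sup id := by rw [hsup]; exact Finset.mem_univ v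
    obtain ⟨X, hX, hv⟩ := Finset.mem_sup.1 this
    exact ⟨⟨X, hX⟩, hv⟩
  choose c hc using hex
  have hcu : ∀ v, ∀ X : {X // X ∈ P}, v ∈ X.1 → c v = X := by
    intro v X hv
    by_contra hcon
    have := hdis (c v).2 X.2 (fun h => hcon (Subtype.ext h))
    exact Finset.disjoint_left.1 this (hc v) hv
  let C := T.filter (nwtX P)
  let M : Multiset (Sym2 {X // X ∈ P}) := C.map (Sym2.map c)
  let G : SimpleGraph {X // X ∈ P} := SimpleGraph.fromEdgeSet {e | e ∈ M}
  have hadj : ∀ a b : V, s(a, b) ∈ T → G.Reachable (c a) (c b) := by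
    intro a b hab
    by_cases h : c a = c b
    · rw [h]
    · refine SimpleGraph.Adj.reachable ?_
      rw [SimpleGraph.fromEdgeSet_adj]
      refine ⟨?_, h⟩
      refine Multiset.mem_map.2 ⟨s(a, b), Multiset.mem_filter.2 ⟨hab, a, b, rfl, (c a).1, (c a).2,
        hc a, fun hb => h (hcu b _ hb).symm⟩, by simp⟩
  have hreach : ∀ u v : V, G.Reachable (c u) (c v) := by
    intro u v
    induction hT u v with
    | refl => exact SimpleGraph.Reachable.refl _
    | tail _ h ih => exact ih.trans (hadj _ _ h)
  have hconn : G.Connected := by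
    have : Nonempty {X // X ∈ P} := ⟨c (Classical.arbitrary V)⟩
    refine SimpleGraph.Connected.mk ?_
    intro X Y
    obtain ⟨u, hu⟩ := hne X.1 X.2
    obtain ⟨v, hv⟩ := hne Y.1 Y.2
    rw [← hcu u X hu, ← hcu v Y hv]
    exact hreach u v
  have h1 := hconn.card_vert_le_card_edgeSet_add_one
  have h2 : Nat.card G.edgeSet ≤ C.card := by
    have hsub : G.edgeSet ⊆ (M.toFinset : Set (Sym2 {X // X ∈ P})) := by
      intro e he
      have he' : e ∈ (SimpleGraph.fromEdgeSet {e | e ∈ M}).edgeSet := he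
      rw [SimpleGraph.edgeSet_fromEdgeSet] at he'
      have h0 : e ∈ M := he'.1
      simpa using h0
    have h3 := Set.ncard_le_ncard hsub (Finset.finite_toSet _)
    rw [Set.ncard_coe_finset] at h3
    have h4 := M.toFinset_card_le
    have h5 : M.card = C.card := Multiset.card_map _ _
    rw [Nat.card_coe_set_eq]
    omega
  have h6 : Nat.card {X // X ∈ P} = P.card := by simp
  have h7 : eCross T P = C.card := nwt_eCross T P
  omega

theorem nwt_forward {V : Type*} [Fintype V] [DecidableEq V] [Nonempty V]
    (E : Multiset (Sym2 V)) (k : ℕ) (T : Fin k → Multiset (Sym2 V))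
    (hT : (∑ i, T i) ≤ E) (hs : ∀ i, IsSpanningTree (T i))
    (P : Finset (Finset V)) (hP : IsPartition P) :
    (eCross E P : ℤ) ≥ (k : ℤ) * ((P.card : ℤ) - 1) := by
  have h1 : eCross (∑ i, T i) P ≤ eCross E P := by
    rw [nwt_eCross, nwt_eCross]
    exact Multiset.card_le_card (Multiset.filter_le_filter _ hT)
  have h2 : eCross (∑ i, T i) P = ∑ i, eCross (T i) P := by
    simp only [nwt_eCross, ← Multiset.countP_eq_card_filter]
    exact map_sum (Multiset.countPAddMonoidHom _) T Finset.univ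
  have h3 : ∀ i, ((P.card : ℤ) - 1) ≤ (eCross (T i) P : ℤ) := by
    intro i
    have := nwt_cross_ge (T i) (hs i).1 P hP
    omega
  have h4 : (k : ℤ) * ((P.card : ℤ) - 1) ≤ ∑ i, (eCross (T i) P : ℤ) := by
    have := Finset.sum_le_sum (fun i (_ : i ∈ (Finset.univ : Finset (Fin k))) => h3 i)
    simpa only [Finset.sum_const, Finset.card_univ, Fintype.card_fin, nsmul_eq_mul] using this
  have h5 : ((∑ i, eCross (T i) P : ℕ) : ℤ) ≤ (eCross E P : ℤ) := by
    exact_mod_cast h2 ▸ h1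
  push_cast at h5
  linarith

/-- Incidence vector of an edge over `ZMod 2`. -/
noncomputable def nwtVec {V : Type*} [DecidableEq V] : Sym2 V → (V → ZMod 2) :=
  Sym2.lift ⟨fun u v => Pi.single u 1 + Pi.single v 1, fun _ _ => add_comm _ _⟩

/-- Sum of coordinates over `S`. -/
noncomputable def nwtSum {V : Type*} (S : Finset V) : (V → ZMod 2) →ₗ[ZMod 2] ZMod 2 :=
  ∑ v ∈ S, LinearMap.proj v

theorem nwtSum_single {V : Type*} [DecidableEq V] (S : Finset V) (v : V) :
    nwtSum S (Pi.single v 1) = if v ∈ S then 1 else 0 := by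
  simp [nwtSum, Pi.single_apply]

theorem nwt_two (a : ZMod 2) : a + a = 0 := by
  revert a; decide

theorem nwt_two' {V : Type*} (a : V → ZMod 2) : a + a = 0 := by
  funext v; exact nwt_two _

theorem nwtSum_univ_vec {V : Type*} [Fintype V] [DecidableEq V] (e : Sym2 V) :
    nwtSum Finset.univ (nwtVec e) = 0 := by
  induction e with
  | h u v =>
    simp only [nwtVec, Sym2.lift_mk, map_add, nwtSum_single, Finset.mem_univ, if_true]
    decide

theorem nwt_ker_lt {V : Type*} [Fintype V] [DecidableEq V] [Nonempty V] :
    Module.finrank (ZMod 2) (LinearMap.ker (nwtSum (Finset.univ : Finset V))) + 1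
      ≤ Fintype.card V := by
  have h : LinearMap.ker (nwtSum (Finset.univ : Finset V)) < ⊤ := by
    rw [lt_top_iff_ne_top]
    intro h
    have : (Pi.single (Classical.arbitrary V) 1 : V → ZMod 2) ∈
        LinearMap.ker (nwtSum (Finset.univ : Finset V)) := by rw [h]; trivial
    rw [LinearMap.mem_ker, nwtSum_single] at this
    simp at this
  have := Submodule.finrank_lt h.ne
  rw [Module.finrank_fintype_fun_eq_card] at this
  exact this

theorem nwt_card_finrank {W ι : Type*} [AddCommGroup W] [Module (ZMod 2) W]
    (x : ι → W) (F : Finset ι) (h : LinearIndepOn (ZMod 2) x (F : Set ι)) :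
    Module.finrank (ZMod 2) (Submodule.span (ZMod 2) (x '' (F : Set ι))) = F.card := by
  have := finrank_span_eq_card h
  rw [Set.image_eq_range]
  simpa using this

theorem nwt_span_le_ker {V ι : Type*} [Fintype V] [DecidableEq V]
    (g : ι → Sym2 V) (F : Set ι) :
    Submodule.span (ZMod 2) ((fun e => nwtVec (g e)) '' F) ≤
      LinearMap.ker (nwtSum (Finset.univ : Finset V)) := by
  rw [Submodule.span_le]
  rintro _ ⟨e, _, rfl⟩
  exact nwtSum_univ_vec _

theorem nwt_indep_card {V ι : Type*} [Fintype V] [DecidableEq V] [Nonempty V]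
    (g : ι → Sym2 V) (F : Finset ι)
    (h : LinearIndepOn (ZMod 2) (fun e => nwtVec (g e)) (F : Set ι)) :
    F.card + 1 ≤ Fintype.card V := by
  rw [← nwt_card_finrank _ F h]
  exact (Nat.add_le_add_right (Submodule.finrank_mono (nwt_span_le_ker g _)) 1).trans nwt_ker_lt

theorem nwt_indep_tree {V ι : Type*} [Fintype V] [DecidableEq V] [Nonempty V]
    (g : ι → Sym2 V) (F : Finset ι)
    (h : LinearIndepOn (ZMod 2) (fun e => nwtVec (g e)) (F : Set ι))
    (hF : F.card + 1 = Fintype.card V) :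
    IsSpanningTree (F.val.map g) := by
  refine ⟨?_, by simpa using hF⟩
  have heq := Submodule.eq_of_le_of_finrank_le (nwt_span_le_ker g (F : Set ι)) (by
    rw [nwt_card_finrank _ F h]
    have := nwt_ker_lt (V := V)
    omega)
  intro u v
  by_contra hcon
  let S : Finset V := Finset.univ.filter
    (fun w => Relation.ReflTransGen (fun a b : V => s(a, b) ∈ F.val.map g) u w)
  have hle : Submodule.span (ZMod 2) ((fun e => nwtVec (g e)) '' (F : Set ι)) ≤
      LinearMap.ker (nwtSum S) := by
    rw [Submodule.span_le]
    rintro _ ⟨e, he, rfl⟩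
    have hmem : g e ∈ F.val.map g := Multiset.mem_map_of_mem g he
    show nwtSum S (nwtVec (g e)) = 0
    revert hmem
    generalize g e = e'
    induction e' with
    | h a b =>
      intro hmem
      have hab : a ∈ S ↔ b ∈ S := by
        simp only [S, Finset.mem_filter, Finset.mem_univ, true_and]
        refine ⟨fun h => h.tail hmem, fun h => h.tail ?_⟩
        rw [Sym2.eq_swap]; exact hmem
      simp only [nwtVec, Sym2.lift_mk, map_add, nwtSum_single, hab]
      exact nwt_two _
  rw [heq] at hle
  have h1 : (Pi.single u 1 + Pi.single v 1 : V → ZMod 2) ∈ LinearMap.ker (nwtSum S) :=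
    hle (nwtSum_univ_vec s(u, v))
  have hu : u ∈ S := by simp [S, Relation.ReflTransGen.refl]
  have hv : v ∉ S := by simpa [S] using hcon
  rw [LinearMap.mem_ker, map_add, nwtSum_single, nwtSum_single, if_pos hu, if_neg hv] at h1
  simp at h1

/-- Partition of the vertices induced by a subspace. -/
theorem nwt_partition {V : Type*} [Fintype V] [DecidableEq V]
    (S : Submodule (ZMod 2) (V → ZMod 2)) :
    ∃ P : Finset (Finset V), IsPartition P ∧
      Fintype.card V ≤ Module.finrank (ZMod 2) S + P.card ∧
      ∀ u v : V, nwtVec s(u, v) ∈ S → ∀ X ∈ P, u ∈ X → v ∈ X := by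
  let d : V → (V → ZMod 2) := fun v => Pi.single v 1
  have hrefl : ∀ u, d u + d u ∈ S := fun u => by rw [nwt_two']; exact S.zero_mem
  have hsymm : ∀ u v, d u + d v ∈ S → d v + d u ∈ S := fun u v h => by rwa [add_comm]
  have htrans : ∀ u v w, d u + d v ∈ S → d v + d w ∈ S → d u + d w ∈ S := by
    intro u v w h1 h2
    have := S.add_mem h1 h2
    have h3 : d u + d v + (d v + d w) = d u + d w := by
      rw [show d u + d v + (d v + d w) = d u + (d v + d v) + d w by abel, nwt_two', add_zero]
    rwa [h3] at this
  let cls : V → Finset V := fun v => Finset.univ.filter (fun w => d v + d w ∈ S)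
  have hmem : ∀ v w, w ∈ cls v ↔ d v + d w ∈ S := fun v w => by simp [cls]
  refine ⟨Finset.univ.image cls, ⟨?_, ?_, ?_⟩, ?_, ?_⟩
  · intro X hX
    obtain ⟨v, -, rfl⟩ := Finset.mem_image.1 hX
    exact ⟨v, (hmem v v).2 (hrefl v)⟩
  · intro X hX Y hY hXY
    obtain ⟨v, -, rfl⟩ := Finset.mem_image.1 (Finset.mem_coe.1 hX)
    obtain ⟨w, -, rfl⟩ := Finset.mem_image.1 (Finset.mem_coe.1 hY)
    rw [Finset.disjoint_left]
    intro a ha hb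
    rw [hmem] at ha hb
    have hvw := htrans _ _ _ ha (hsymm _ _ hb)
    apply hXY
    ext z
    rw [hmem, hmem]
    exact ⟨fun h => htrans _ _ _ (hsymm _ _ hvw) h, fun h => htrans _ _ _ hvw h⟩
  · rw [Finset.eq_univ_iff_forall]
    intro v
    exact Finset.mem_sup.2 ⟨cls v, Finset.mem_image_of_mem _ (Finset.mem_univ v),
      (hmem v v).2 (hrefl v)⟩
  · have hr : ∀ X : Finset V, ∃ f : V → ZMod 2, ∀ v, X = cls v → d v + f ∈ S := by
      intro X
      by_cases hX : ∃ v, X = cls v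
      · obtain ⟨v, rfl⟩ := hX
        refine ⟨d v, fun w hw => ?_⟩
        rw [← hmem, ← hw, hmem]
        exact hrefl v
      · exact ⟨0, fun v hv => (hX ⟨v, hv⟩).elim⟩
    choose r hr using hr
    let Q : Finset (V → ZMod 2) := (Finset.univ.image cls).image r
    have htop : S ⊔ Submodule.span (ZMod 2) (Q : Set (V → ZMod 2)) = ⊤ := by
      rw [eq_top_iff, ← (Pi.basisFun (ZMod 2) V).span_eq, Submodule.span_le]
      rintro _ ⟨v, rfl⟩
      have h1 : d v = (d v + r (cls v)) + r (cls v) := by rw [add_assoc, nwt_two', add_zero]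
      rw [Pi.basisFun_apply]
      show d v ∈ _
      rw [h1]
      refine Submodule.add_mem_sup (hr _ v rfl) (Submodule.subset_span ?_)
      exact Finset.mem_coe.2 (Finset.mem_image_of_mem _
        (Finset.mem_image_of_mem _ (Finset.mem_univ v)))
    have h2 := Submodule.finrank_add_le_finrank_add_finrank S
      (Submodule.span (ZMod 2) (Q : Set (V → ZMod 2)))
    rw [htop, finrank_top, Module.finrank_fintype_fun_eq_card] at h2
    have h3 : Module.finrank (ZMod 2) (Submodule.span (ZMod 2) (Q : Set (V → ZMod 2))) ≤ Q.card :=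
      finrank_span_finset_le_card Q
    have h4 : Q.card ≤ (Finset.univ.image cls).card := Finset.card_image_le
    omega
  · intro u v huv X hX hu
    obtain ⟨w, -, rfl⟩ := Finset.mem_image.1 hX
    rw [hmem] at hu ⊢
    exact htrans _ _ _ hu huv

theorem nwt_backward {V : Type*} [Fintype V] [DecidableEq V] [Nonempty V]
    (E : Multiset (Sym2 V)) (k : ℕ)
    (h : ∀ P : Finset (Finset V), IsPartition P →
        (eCross E P : ℤ) ≥ (k : ℤ) * ((P.card : ℤ) - 1)) :
    ∃ T : Fin k → Multiset (Sym2 V),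
        (∑ i, T i) ≤ E ∧ ∀ i, IsSpanningTree (T i) := by
  obtain ⟨n, g, rfl⟩ : ∃ (n : ℕ) (g : Fin n → Sym2 V), E = Finset.univ.val.map g := by
    induction E using Quotient.inductionOn with
    | h L => exact ⟨L.length, L.get, by rw [Fin.univ_val_map, List.ofFn_get]; rfl⟩
  obtain ⟨c, A, hind, hnone, hspan⟩ := nwt_union (K := ZMod 2) (fun e => nwtVec (g e)) k
  let F : Fin k → Finset (Fin n) := fun i => Finset.univ.filter (fun e => c e = some i)
  have hFind : ∀ i, LinearIndepOn (ZMod 2) (fun e => nwtVec (g e)) (F i : Set (Fin n)) := by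
    intro i
    have := hind i
    simpa [F] using this
  obtain ⟨P, hP, hPc, hPe⟩ :=
    nwt_partition (Submodule.span (ZMod 2) ((fun e => nwtVec (g e)) '' A))
  have hA : ∀ i, Module.finrank (ZMod 2) (Submodule.span (ZMod 2) ((fun e => nwtVec (g e)) '' A))
      ≤ ((F i).filter (· ∈ A)).card := by
    intro i
    have hset : {e | c e = some i ∧ e ∈ A} = (((F i).filter (· ∈ A) : Finset (Fin n)) : Set _) := by
      ext e; simp [F]
    have hi := hspan i
    rw [hset] at hi
    rw [← nwt_card_finrank (fun e => nwtVec (g e)) ((F i).filter (· ∈ A))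
      ((hFind i).mono (by intro e; simp; tauto))]
    refine Submodule.finrank_mono ?_
    rw [Submodule.span_le]
    rintro _ ⟨e, he, rfl⟩
    exact hi e he
  have hcross : eCross (Finset.univ.val.map g) P ≤ ∑ i, ((F i).filter (· ∉ A)).card := by
    have h1 : eCross (Finset.univ.val.map g) P = (Finset.univ.filter
        (fun e => nwtX P (g e))).card := by
      rw [nwt_eCross, Multiset.filter_map, Multiset.card_map]
      rfl
    rw [h1]
    refine le_trans (Finset.card_le_card ?_) Finset.card_biUnion_le
    intro e he
    obtain ⟨u, v, huv, X, hX, hu, hv⟩ := (Finset.mem_filter.1 he).2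
    have heA : e ∉ A := by
      intro heA
      refine hv (hPe u v ?_ X hX hu)
      rw [← huv]
      exact Submodule.subset_span ⟨e, heA, rfl⟩
    rcases hce : c e with _ | i
    · exact (heA (hnone e hce)).elim
    · simp only [Finset.mem_biUnion, Finset.mem_filter, Finset.mem_univ, true_and, F]
      exact ⟨i, hce, heA⟩
  have hle : ∀ i, (F i).card + 1 ≤ Fintype.card V := fun i => nwt_indep_card g (F i) (hFind i)
  have hbound : ∀ i, (((F i).filter (· ∉ A)).card : ℤ) ≤
      ((F i).card : ℤ) + 1 - Fintype.card V + ((P.card : ℤ) - 1) := by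
    intro i
    have h1 := hA i
    have h2 := Finset.card_filter_add_card_filter_not (s := F i) (· ∈ A)
    omega
  have hsum : ∑ i, (((F i).card : ℤ) + 1 - Fintype.card V) ≥ 0 := by
    have h1 := h P hP
    have h2 : (eCross (Finset.univ.val.map g) P : ℤ) ≤
      ∑ i, (((F i).filter (· ∉ A)).card : ℤ) := by exact_mod_cast hcross
    have h3 := Finset.sum_le_sum (fun i (_ : i ∈ (Finset.univ : Finset (Fin k))) => hbound i)
    rw [Finset.sum_add_distrib] at h3
    simp only [Finset.sum_const, Finset.card_univ, Fintype.card_fin, nsmul_eq_mul] at h3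
    linarith
  have heq : ∀ i, (F i).card + 1 = Fintype.card V := by
    intro i
    have h1 : ∀ j ∈ (Finset.univ : Finset (Fin k)),
        ((F j).card : ℤ) + 1 - Fintype.card V ≤ 0 := by
      intro j _
      have := hle j
      omega
    have h2 := (Finset.sum_eq_zero_iff_of_nonpos h1).1
      (le_antisymm (Finset.sum_nonpos h1) hsum) i (Finset.mem_univ i)
    omega
  refine ⟨fun i => (F i).val.map g, ?_, fun i => nwt_indep_tree g (F i) (hFind i) (heq i)⟩
  have h1 : ∑ i, (F i).val.map g = (∑ i, (F i).val).map g :=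
    (map_sum (Multiset.mapAddMonoidHom g) (fun i => (F i).val) Finset.univ).symm
  rw [h1]
  refine Multiset.map_le_map ?_
  rw [Multiset.le_iff_count]
  intro e
  rw [Multiset.count_sum', Multiset.count_eq_one_of_mem Finset.univ.nodup (Finset.mem_univ e)]
  have h2 : ∀ i, Multiset.count e (F i).val = if c e = some i then 1 else 0 := by
    intro i
    rw [Multiset.count_eq_of_nodup (F i).nodup]
    simp [F]
  simp only [h2]
  rcases c e with _ | j
  · simp
  · simp

/-- **Nash-Williams–Tutte theorem.**  A finite loopless multigraph `G = (V, E)`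
contains `k` edge-disjoint spanning trees if and only if for every partition
`P = {X₀, X₁, …, X_t}` of `V` into nonempty parts, the number of edges joining
distinct parts is at least `kt = k(|P| - 1)`. -/
theorem nash_williams_tutte
    {V : Type*} [Fintype V] [DecidableEq V] [Nonempty V]
    (E : Multiset (Sym2 V)) (hE : ∀ e ∈ E, ¬ e.IsDiag) (k : ℕ) :
    (∃ T : Fin k → Multiset (Sym2 V),
        (∑ i, T i) ≤ E ∧ ∀ i, IsSpanningTree (T i)) ↔
      ∀ P : Finset (Finset V), IsPartition P →
        (eCross E P : ℤ) ≥ (k : ℤ) * ((P.card : ℤ) - 1) := by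
  constructor
  · rintro ⟨T, hT, hs⟩ P hP
    exact nwt_forward E k T hT hs P hP
  · exact nwt_backward E k
end
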